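/- No proper supersets of the true model (Theorem 2): assume s* ≤ R, conditions (A1)–(A3), and that the constant a in the prior on models satisfies p^a/s* → ∞. Then E_{β*}[Π^n({β : S_β ⊋ S*})] → 0 as n → ∞, uniformly over all true coefficient vectors β* satisfying the assumptions. -/

import Mathlib

open MeasureTheory ProbabilityTheory Real Filter Matrix
open scoped ENNReal NNReal BigOperators Classical

noncomputable section

namespace EmpiricalBayes

/-- Submatrix of columns of `X` indexed by `S`. -/
def XS {n p : ℕ} (X : Matrix (Fin n) (Fin p) ℝ) (S : Finset (Fin p)) :
    Matrix (Fin n) {j // j ∈ S} ℝ := Matrix.of fun i j => X i j.1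

/-- The Gram matrix `X_Sᵀ X_S`. -/
def gram {n p : ℕ} (X : Matrix (Fin n) (Fin p) ℝ) (S : Finset (Fin p)) :
    Matrix {j // j ∈ S} {j // j ∈ S} ℝ := (XS X S)ᵀ * XS X S

/-- Least squares estimator `β̂_S = (X_SᵀX_S)⁻¹X_Sᵀ y`. -/
def betaHat {n p : ℕ} (X : Matrix (Fin n) (Fin p) ℝ) (S : Finset (Fin p))
    (y : Fin n → ℝ) : {j // j ∈ S} → ℝ := ((gram X S)⁻¹ * (XS X S)ᵀ).mulVec y

/-- Fitted values `ŷ_S = X_S β̂_S`. -/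
def yHat {n p : ℕ} (X : Matrix (Fin n) (Fin p) ℝ) (S : Finset (Fin p))
    (y : Fin n → ℝ) : Fin n → ℝ := (XS X S).mulVec (betaHat X S y)

/-- Residual sum of squares `‖y - ŷ_S‖²`. -/
def rss {n p : ℕ} (X : Matrix (Fin n) (Fin p) ℝ) (S : Finset (Fin p))
    (y : Fin n → ℝ) : ℝ := ∑ i, (y i - yHat X S y i) ^ 2

/-- Quadratic form `(β_S - β̂_S)ᵀ X_SᵀX_S (β_S - β̂_S)`. -/
def quadForm {n p : ℕ} (X : Matrix (Fin n) (Fin p) ℝ) (S : Finset (Fin p))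
    (y : Fin n → ℝ) (b : {j // j ∈ S} → ℝ) : ℝ :=
  (b - betaHat X S y) ⬝ᵥ ((gram X S).mulVec (b - betaHat X S y))

/-- Prior weight `π(S) = binom(p,|S|)⁻¹ (c p^a)^{-|S|}` for `|S| ≤ R`, `0` otherwise
(the normalizing constant of `f_n` is irrelevant, as it cancels in the posterior). -/
def priorWt (p R : ℕ) (a c : ℝ) (S : Finset (Fin p)) : ℝ :=
  if S.card ≤ R then ((p.choose S.card : ℝ))⁻¹ * (c * (p : ℝ) ^ a) ^ (-(S.card : ℝ)) else 0

/-- Exponent `nα/2 + s/2 + a₀` of the multivariate t kernel. -/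
def tExp (n : ℕ) (α a₀ : ℝ) (s : ℕ) : ℝ := n * α / 2 + s / 2 + a₀

/-- The (unnormalized) density `D_S^n(β_S)` of the empirical Bayes posterior on model `S`. -/
def Ddens {n p : ℕ} (R : ℕ) (X : Matrix (Fin n) (Fin p) ℝ) (a₀ b₀ a c γ α : ℝ)
    (y : Fin n → ℝ) (S : Finset (Fin p)) (b : {j // j ∈ S} → ℝ) : ℝ :=
  priorWt p R a c S * (2 * π) ^ (-(S.card : ℝ) / 2) * Real.Gamma (tExp n α a₀ S.card) *
    Real.sqrt ((γ • gram X S).det) *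
    (b₀ + (α + γ) / 2 * quadForm X S y b + α / 2 * rss X S y) ^ (-(tExp n α a₀ S.card))

/-- Augment `β_S` with zeros outside `S`. -/
def augment {p : ℕ} (S : Finset (Fin p)) (b : {j // j ∈ S} → ℝ) : Fin p → ℝ :=
  fun j => if h : j ∈ S then b ⟨j, h⟩ else 0

/-- The contribution `∫ D_S^n(dβ_S) δ_0(dβ_{S^c})` of model `S` to the (unnormalized)
empirical Bayes posterior. -/
def modelMeasure {n p : ℕ} (R : ℕ) (X : Matrix (Fin n) (Fin p) ℝ) (a₀ b₀ a c γ α : ℝ)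
    (y : Fin n → ℝ) (S : Finset (Fin p)) : Measure (Fin p → ℝ) :=
  Measure.map (augment S)
    ((volume : Measure ({j // j ∈ S} → ℝ)).withDensity
      fun b => ENNReal.ofReal (Ddens R X a₀ b₀ a c γ α y S b))

/-- The unnormalized empirical Bayes posterior `Σ_S ∫ D_S^n(dβ_S) δ_0(dβ_{S^c})`. -/
def postUnnorm {n p : ℕ} (R : ℕ) (X : Matrix (Fin n) (Fin p) ℝ) (a₀ b₀ a c γ α : ℝ)
    (y : Fin n → ℝ) : Measure (Fin p → ℝ) :=
  ∑ S : Finset (Fin p), modelMeasure R X a₀ b₀ a c γ α y S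

/-- The empirical Bayes posterior `Π^n` on `ℝ^p`. -/
def post {n p : ℕ} (R : ℕ) (X : Matrix (Fin n) (Fin p) ℝ) (a₀ b₀ a c γ α : ℝ)
    (y : Fin n → ℝ) : Measure (Fin p → ℝ) :=
  (postUnnorm R X a₀ b₀ a c γ α y Set.univ)⁻¹ • postUnnorm R X a₀ b₀ a c γ α y

/-- The Gaussian measure `N_n(m, v I_n)` on `ℝⁿ`. -/
def gaussVec (n : ℕ) (m : Fin n → ℝ) (v : ℝ) : Measure (Fin n → ℝ) :=
  Measure.pi fun i => gaussianReal (m i) v.toNNReal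

/-- The sampling distribution of the data, `y ~ N_n(Xβ*, σ₀² I_n)`. -/
def dataDist {n p : ℕ} (X : Matrix (Fin n) (Fin p) ℝ) (βstar : Fin p → ℝ)
    (σ0sq : ℝ) : Measure (Fin n → ℝ) := gaussVec n (X.mulVec βstar) σ0sq

/-- Unnormalized marginal posterior model weight
`π(S)(γ/(α+γ))^{|S|/2}(b₀ + α‖y-ŷ_S‖²/2)^{-(a₀+αn/2)}`. -/
def modelWt {n p : ℕ} (R : ℕ) (X : Matrix (Fin n) (Fin p) ℝ) (a₀ b₀ a c γ α : ℝ)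
    (y : Fin n → ℝ) (S : Finset (Fin p)) : ℝ :=
  priorWt p R a c S * (γ / (α + γ)) ^ ((S.card : ℝ) / 2) *
    (b₀ + α / 2 * rss X S y) ^ (-(a₀ + α * n / 2))

/-- The marginal posterior probability `π^n(S)` of model `S`. -/
def postModel {n p : ℕ} (R : ℕ) (X : Matrix (Fin n) (Fin p) ℝ) (a₀ b₀ a c γ α : ℝ)
    (y : Fin n → ℝ) (S : Finset (Fin p)) : ℝ :=
  modelWt R X a₀ b₀ a c γ α y S / ∑ S' : Finset (Fin p), modelWt R X a₀ b₀ a c γ α y S'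

/-- The compatibility number `κ(s) = inf{‖Xβ‖₂/‖β‖₂ : 0 < |S_β| ≤ s}`. -/
def kappa {n p : ℕ} (X : Matrix (Fin n) (Fin p) ℝ) (s : ℝ) : ℝ :=
  sInf ((fun β : Fin p → ℝ =>
      Real.sqrt (∑ i, (X.mulVec β i) ^ 2) / Real.sqrt (∑ j, β j ^ 2)) ''
    {β | 0 < (Function.support β).ncard ∧ ((Function.support β).ncard : ℝ) ≤ s})

/-- Orthogonal projection `P_S = X_S(X_SᵀX_S)⁻¹X_Sᵀ` onto the column span of `X_S`. -/
def projMat {n p : ℕ} (X : Matrix (Fin n) (Fin p) ℝ) (S : Finset (Fin p)) :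
    Matrix (Fin n) (Fin n) ℝ := XS X S * (gram X S)⁻¹ * (XS X S)ᵀ

/-- Support of a coefficient vector as a `Finset`. -/
def suppFinset {p : ℕ} (β : Fin p → ℝ) : Finset (Fin p) :=
  Finset.univ.filter fun j => β j ≠ 0


theorem integrable_exp_sq_gaussianReal {q : ℝ} (hq : q < 1) :
    Integrable (fun x : ℝ => Real.exp (q / 2 * x ^ 2)) (gaussianReal 0 1) := by
  rw [gaussianReal_of_var_ne_zero _ one_ne_zero]
  rw [integrable_withDensity_iff (by fun_prop) (by simp [gaussianPDF])]
  have h := (integrable_exp_neg_mul_sq (b := (1 - q) / 2) (by linarith)).const_mul (√(2 * π))⁻¹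
  refine h.congr (ae_of_all _ fun x => ?_)
  simp only [toReal_gaussianPDF, gaussianPDFReal, NNReal.coe_one, mul_one, sub_zero]
  rw [mul_left_comm, ← Real.exp_add]
  congr 2
  ring

theorem integral_exp_sq_gaussianReal {q : ℝ} (hq : q < 1) :
    ∫ x, Real.exp (q / 2 * x ^ 2) ∂(gaussianReal 0 1) = (1 - q) ^ (-(1 : ℝ) / 2) := by
  rw [integral_gaussianReal_eq_integral_smul one_ne_zero]
  have h : ∀ x : ℝ, gaussianPDFReal 0 1 x • Real.exp (q / 2 * x ^ 2) =
      (√(2 * π))⁻¹ * Real.exp (-((1 - q) / 2) * x ^ 2) := fun x => by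
    simp only [gaussianPDFReal, NNReal.coe_one, mul_one, sub_zero, smul_eq_mul]
    rw [mul_assoc, ← Real.exp_add]
    congr 2
    ring
  have h1 : 0 < 1 - q := by linarith
  simp_rw [h, integral_const_mul, integral_gaussian]
  rw [← Real.sqrt_inv, ← Real.sqrt_mul (by positivity)]
  rw [neg_div, Real.rpow_neg h1.le, ← Real.sqrt_eq_rpow, ← Real.sqrt_inv]
  congr 1
  field_simp

section QuadraticForm

variable {n : ℕ} {M : Matrix (Fin n) (Fin n) ℝ}

theorem eigenvalues_eq_zero_or_one (hM : M.IsHermitian) (hid : M * M = M) (i : Fin n) :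
    hM.eigenvalues i = 0 ∨ hM.eigenvalues i = 1 := by
  have h := hM.mulVec_eigenvectorBasis i
  have h2 : M *ᵥ (M *ᵥ ⇑(hM.eigenvectorBasis i)) = M *ᵥ ⇑(hM.eigenvectorBasis i) := by
    rw [mulVec_mulVec, hid]
  rw [h, mulVec_smul, h, smul_smul] at h2
  have hne : (⇑(hM.eigenvectorBasis i) : Fin n → ℝ) ≠ 0 := by
    intro h0
    apply hM.eigenvectorBasis.orthonormal.ne_zero i
    ext j
    exact congrFun h0 j
  have h3 := smul_left_injective ℝ hne h2
  have : hM.eigenvalues i * (hM.eigenvalues i - 1) = 0 := by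
    linarith
  rcases mul_eq_zero.1 this with h | h
  · exact Or.inl h
  · exact Or.inr (by linarith)

theorem quadratic_sum_eigenvectorBasis (hM : M.IsHermitian) (x : Fin n → ℝ) :
    (⇑(∑ i, x i • hM.eigenvectorBasis i) : Fin n → ℝ) ⬝ᵥ
      (M *ᵥ ⇑(∑ i, x i • hM.eigenvectorBasis i)) = ∑ i, hM.eigenvalues i * x i ^ 2 := by
  have hMv : M *ᵥ ⇑(∑ i, x i • hM.eigenvectorBasis i) =
      ⇑(∑ i, (x i * hM.eigenvalues i) • hM.eigenvectorBasis i) := by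
    simp only [WithLp.ofLp_sum, WithLp.ofLp_smul, mulVec_sum, mulVec_smul,
      hM.mulVec_eigenvectorBasis, smul_smul]
  have hin : ∀ u v : EuclideanSpace ℝ (Fin n), (⇑u : Fin n → ℝ) ⬝ᵥ ⇑v = inner ℝ u v := by
    intro u v
    simp [PiLp.inner_apply, dotProduct, mul_comm]
  rw [hMv, hin, hM.eigenvectorBasis.orthonormal.inner_sum]
  refine Finset.sum_congr rfl fun i _ => ?_
  simp
  ring

theorem map_eigenvectorBasis_pi (hM : M.IsHermitian) :
    (Measure.pi fun _ : Fin n => gaussianReal 0 1).map (WithLp.toLp 2) =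
      (Measure.pi fun _ : Fin n => gaussianReal 0 1).map
        (fun x => ∑ i, x i • hM.eigenvectorBasis i) := by
  rw [map_pi_eq_stdGaussian, ← stdGaussian_eq_map_pi_orthonormalBasis]

theorem exp_quadratic_eq_prod (hM : M.IsHermitian) (q : ℝ) (x : Fin n → ℝ) :
    Real.exp (q / 2 * ((⇑(∑ i, x i • hM.eigenvectorBasis i) : Fin n → ℝ) ⬝ᵥ
      (M *ᵥ ⇑(∑ i, x i • hM.eigenvectorBasis i)))) =
      ∏ i, Real.exp (q * hM.eigenvalues i / 2 * x i ^ 2) := by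
  rw [quadratic_sum_eigenvectorBasis, ← Real.exp_sum, Finset.mul_sum]
  congr 1
  exact Finset.sum_congr rfl fun i _ => by ring

/-- Moment generating function of a quadratic form given by an orthogonal projection. -/
theorem exp_quadratic_projection (hM : M.IsHermitian) (hid : M * M = M) {q : ℝ} (hq : q < 1) :
    Integrable (fun x : Fin n → ℝ => Real.exp (q / 2 * (x ⬝ᵥ (M *ᵥ x))))
        (Measure.pi fun _ : Fin n => gaussianReal 0 1) ∧
      ∫ x : Fin n → ℝ, Real.exp (q / 2 * (x ⬝ᵥ (M *ᵥ x)))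
        ∂(Measure.pi fun _ : Fin n => gaussianReal 0 1) = (1 - q) ^ (-M.trace / 2) := by
  have hlt : ∀ i, q * hM.eigenvalues i < 1 := fun i => by
    rcases eigenvalues_eq_zero_or_one hM hid i with h | h <;> rw [h] <;> linarith
  set F : EuclideanSpace ℝ (Fin n) → ℝ :=
    fun z => Real.exp (q / 2 * ((⇑z : Fin n → ℝ) ⬝ᵥ (M *ᵥ ⇑z))) with hF
  have hFc : Continuous F := by
    simp only [hF, dotProduct, mulVec]
    fun_prop
  have hT : Measurable (WithLp.toLp 2 : (Fin n → ℝ) → EuclideanSpace ℝ (Fin n)) := by fun_prop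
  have hB : Measurable (fun x : Fin n → ℝ => ∑ i, x i • hM.eigenvectorBasis i) := by fun_prop
  constructor
  · have h1 : Integrable F ((Measure.pi fun _ : Fin n => gaussianReal 0 1).map (WithLp.toLp 2)) := by
      rw [map_eigenvectorBasis_pi hM, integrable_map_measure (by fun_prop) hB.aemeasurable]
      have : F ∘ (fun x : Fin n → ℝ => ∑ i, x i • hM.eigenvectorBasis i) =
          fun x => ∏ i, Real.exp (q * hM.eigenvalues i / 2 * x i ^ 2) := by
        ext x
        exact exp_quadratic_eq_prod hM q x
      rw [this]
      exact Integrable.fintype_prod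
        (f := fun i (x : ℝ) => Real.exp (q * hM.eigenvalues i / 2 * x ^ 2))
        fun i => integrable_exp_sq_gaussianReal (hlt i)
    exact (integrable_map_measure hFc.aestronglyMeasurable hT.aemeasurable).1 h1
  · have h1 : ∫ x : Fin n → ℝ, Real.exp (q / 2 * (x ⬝ᵥ (M *ᵥ x)))
        ∂(Measure.pi fun _ : Fin n => gaussianReal 0 1) =
        ∫ z, F z ∂((Measure.pi fun _ : Fin n => gaussianReal 0 1).map (WithLp.toLp 2)) :=
      (integral_map hT.aemeasurable hFc.aestronglyMeasurable).symm
    rw [h1, map_eigenvectorBasis_pi hM, integral_map hB.aemeasurable hFc.aestronglyMeasurable]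
    simp_rw [hF, exp_quadratic_eq_prod hM q]
    rw [integral_fintype_prod_eq_prod
      (f := fun i (x : ℝ) => Real.exp (q * hM.eigenvalues i / 2 * x ^ 2))]
    simp_rw [fun i => integral_exp_sq_gaussianReal (hlt i)]
    have h2 : ∀ i, (1 - q * hM.eigenvalues i) ^ (-(1 : ℝ) / 2) =
        (1 - q) ^ (-hM.eigenvalues i / 2) := fun i => by
      rcases eigenvalues_eq_zero_or_one hM hid i with h | h <;> rw [h] <;> simp
    simp_rw [h2]
    rw [← Real.rpow_sum_of_pos (by linarith), hM.trace_eq_sum_eigenvalues]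
    congr 1
    simp only [RCLike.ofReal_real_eq_id, id_eq, neg_div, Finset.sum_neg_distrib, Finset.sum_div]

end QuadraticForm

theorem gaussVec_eq_map (n : ℕ) (m : Fin n → ℝ) {v : ℝ} (hv : 0 < v) :
    (Measure.pi fun i => gaussianReal (m i) v.toNNReal) =
      (Measure.pi fun _ : Fin n => gaussianReal 0 1).map (fun x i => m i + √v * x i) := by
  have h : ∀ i, gaussianReal (m i) v.toNNReal =
      (gaussianReal 0 1).map (fun x : ℝ => m i + √v * x) := fun i => by
    have h1 : (fun x : ℝ => m i + √v * x) = (fun x => m i + x) ∘ (fun x => √v * x) := rfl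
    rw [h1, ← Measure.map_map (by fun_prop) (by fun_prop), gaussianReal_map_const_mul,
      gaussianReal_map_const_add]
    congr 1
    · simp
    · ext
      simp [Real.sq_sqrt hv.le, hv.le]
  simp_rw [h]
  exact (Measure.pi_map_pi (f := fun i (x : ℝ) => m i + √v * x)
    fun i => by fun_prop).symm

section StudentIntegral

variable {ι : Type*} [Fintype ι]

theorem lintegral_exp_neg_mul_sum_sq {κ : ℝ} (hκ : 0 < κ) :
    ∫⁻ u : ι → ℝ, ENNReal.ofReal (Real.exp (-κ * ∑ i, u i ^ 2)) =
      ENNReal.ofReal ((π / κ) ^ ((Fintype.card ι : ℝ) / 2)) := by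
  have h : ∀ u : ι → ℝ, Real.exp (-κ * ∑ i, u i ^ 2) = ∏ i, Real.exp (-κ * u i ^ 2) := fun u => by
    rw [← Real.exp_sum, Finset.mul_sum]
  simp_rw [h]
  have hint : Integrable fun u : ι → ℝ => ∏ i, Real.exp (-κ * u i ^ 2) :=
    Integrable.fintype_prod (f := fun _ (x : ℝ) => Real.exp (-κ * x ^ 2))
      fun _ => integrable_exp_neg_mul_sq hκ
  rw [← ofReal_integral_eq_lintegral_ofReal hint
    (ae_of_all _ fun u => Finset.prod_nonneg fun i _ => (Real.exp_pos _).le),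
    integral_fintype_prod_volume_eq_pow (fun x : ℝ => Real.exp (-κ * x ^ 2)), integral_gaussian]
  congr 1
  rw [Real.sqrt_eq_rpow, ← Real.rpow_natCast, ← Real.rpow_mul (by positivity)]
  congr 1
  ring

variable [DecidableEq ι]

open scoped MatrixOrder in
theorem lintegral_exp_neg_mul_quadratic {G : Matrix ι ι ℝ} (hG : G.PosDef) {κ : ℝ} (hκ : 0 < κ) :
    ∫⁻ b : ι → ℝ, ENNReal.ofReal (Real.exp (-κ * (b ⬝ᵥ (G *ᵥ b)))) =
      ENNReal.ofReal ((π / κ) ^ ((Fintype.card ι : ℝ) / 2) * (√G.det)⁻¹) := by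
  obtain ⟨A, hA⟩ := CStarAlgebra.nonneg_iff_eq_star_mul_self.mp hG.posSemidef.nonneg
  have hA' : G = Aᵀ * A := by
    rw [hA, star_eq_conjTranspose, conjTranspose_eq_transpose_of_trivial]
  have hdet : G.det = A.det ^ 2 := by rw [hA', det_mul, det_transpose, sq]
  have hA0 : A.det ≠ 0 := fun h => by
    have := hG.det_pos
    rw [hdet, h] at this
    simp at this
  have hq : ∀ b : ι → ℝ, b ⬝ᵥ (G *ᵥ b) = ∑ i, (toLin' A b) i ^ 2 := fun b => by
    rw [hA', ← mulVec_mulVec, dotProduct_mulVec, vecMul_transpose]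
    simp [dotProduct, sq]
  have hmeas : Measurable fun u : ι → ℝ => ENNReal.ofReal (Real.exp (-κ * ∑ i, u i ^ 2)) := by
    fun_prop
  have hlin : Measurable (toLin' A) := (toLin' A).continuous_of_finiteDimensional.measurable
  simp_rw [hq]
  rw [← lintegral_map hmeas hlin, Real.map_matrix_volume_pi_eq_smul_volume_pi hA0,
    lintegral_smul_measure, lintegral_exp_neg_mul_sum_sq hκ, smul_eq_mul,
    ← ENNReal.ofReal_mul (abs_nonneg _), hdet, Real.sqrt_sq_eq_abs, abs_inv, mul_comm]

theorem lintegral_rpow_mul_exp_neg {t D : ℝ} (ht : 0 < t) (hD : 0 < D) :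
    ∫⁻ v in Set.Ioi (0 : ℝ), ENNReal.ofReal (v ^ (t - 1) * Real.exp (-(D * v))) =
      ENNReal.ofReal (Real.Gamma t * D ^ (-t)) := by
  have hint : IntegrableOn (fun v : ℝ => v ^ (t - 1) * Real.exp (-(D * v))) (Set.Ioi 0) := by
    have := integrableOn_rpow_mul_exp_neg_mul_rpow (s := t - 1) (p := 1) (by linarith) one_pos hD
    simpa using this
  rw [← ofReal_integral_eq_lintegral_ofReal hint, Real.integral_rpow_mul_exp_neg_mul_Ioi ht hD,
    one_div, Real.inv_rpow hD.le, ← Real.rpow_neg hD.le, mul_comm]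
  filter_upwards [ae_restrict_mem measurableSet_Ioi] with v hv
  have : (0 : ℝ) < v := hv
  positivity

/-- Normalizing constant of the multivariate Student kernel. -/
theorem lintegral_student {G : Matrix ι ι ℝ} (hG : G.PosDef) {C h m t : ℝ} (hC : 0 < C)
    (hh : 0 < h) (hm : 0 < m) (ht : t = m + (Fintype.card ι : ℝ) / 2) :
    ENNReal.ofReal (Real.Gamma t) *
        ∫⁻ b : ι → ℝ, ENNReal.ofReal ((C + h * (b ⬝ᵥ (G *ᵥ b))) ^ (-t)) =
      ENNReal.ofReal ((π / h) ^ ((Fintype.card ι : ℝ) / 2) * (√G.det)⁻¹ *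
        (Real.Gamma m * C ^ (-m))) := by
  have ht0 : 0 < t := by rw [ht]; positivity
  have hQ : ∀ b : ι → ℝ, 0 ≤ b ⬝ᵥ (G *ᵥ b) := fun b => by
    simpa using hG.posSemidef.dotProduct_mulVec_nonneg b
  have hQc : Continuous fun b : ι → ℝ => b ⬝ᵥ (G *ᵥ b) := by
    simp only [dotProduct, mulVec]
    fun_prop
  have hQm := hQc.measurable
  rw [← lintegral_const_mul _ (by fun_prop)]
  have h1 : ∀ b : ι → ℝ, ENNReal.ofReal (Real.Gamma t) *
      ENNReal.ofReal ((C + h * (b ⬝ᵥ (G *ᵥ b))) ^ (-t)) =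
      ∫⁻ v in Set.Ioi (0 : ℝ), ENNReal.ofReal (v ^ (t - 1) *
        Real.exp (-((C + h * (b ⬝ᵥ (G *ᵥ b))) * v))) := fun b => by
    have := mul_nonneg hh.le (hQ b)
    rw [lintegral_rpow_mul_exp_neg ht0 (by linarith),
      ENNReal.ofReal_mul (Real.Gamma_pos_of_pos ht0).le]
  simp_rw [h1]
  rw [lintegral_lintegral_swap (by
    apply Measurable.aemeasurable
    simp only [Function.uncurry_def]
    fun_prop)]
  have h2 : ∀ v ∈ Set.Ioi (0 : ℝ), ∫⁻ b : ι → ℝ, ENNReal.ofReal (v ^ (t - 1) *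
        Real.exp (-((C + h * (b ⬝ᵥ (G *ᵥ b))) * v))) =
      ENNReal.ofReal ((π / h) ^ ((Fintype.card ι : ℝ) / 2) * (√G.det)⁻¹) *
        ENNReal.ofReal (v ^ (m - 1) * Real.exp (-(C * v))) := fun v hv => by
    have hv : 0 < v := hv
    have h3 : ∀ b : ι → ℝ, ENNReal.ofReal (v ^ (t - 1) *
        Real.exp (-((C + h * (b ⬝ᵥ (G *ᵥ b))) * v))) =
        ENNReal.ofReal (v ^ (t - 1) * Real.exp (-(C * v))) *
          ENNReal.ofReal (Real.exp (-(h * v) * (b ⬝ᵥ (G *ᵥ b)))) := fun b => by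
      rw [← ENNReal.ofReal_mul (by positivity), mul_assoc, ← Real.exp_add]
      congr 3
      ring
    simp_rw [h3]
    rw [lintegral_const_mul _ (by fun_prop),
      lintegral_exp_neg_mul_quadratic hG (mul_pos hh hv), ← ENNReal.ofReal_mul (by positivity),
      ← ENNReal.ofReal_mul (by positivity)]
    congr 1
    have h4 : (π / (h * v)) ^ ((Fintype.card ι : ℝ) / 2) =
        (π / h) ^ ((Fintype.card ι : ℝ) / 2) * v ^ (-((Fintype.card ι : ℝ) / 2)) := by
      rw [← div_div, Real.div_rpow (by positivity) hv.le, Real.rpow_neg hv.le, div_eq_mul_inv]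
    have h5 : v ^ (m - 1) = v ^ (t - 1) * v ^ (-((Fintype.card ι : ℝ) / 2)) := by
      rw [← Real.rpow_add hv, ht]
      congr 1
      ring
    rw [h4, h5]
    ring
  rw [setLIntegral_congr_fun measurableSet_Ioi h2, lintegral_const_mul _ (by fun_prop),
    lintegral_rpow_mul_exp_neg hm hC, ← ENNReal.ofReal_mul (by positivity)]

end StudentIntegral

section Projection

variable {n p : ℕ} {X : Matrix (Fin n) (Fin p) ℝ} {S T : Finset (Fin p)}

theorem projMat_transpose : (projMat X S)ᵀ = projMat X S := by
  have h : (gram X S)ᵀ = gram X S := by simp [gram, transpose_mul]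
  rw [projMat, transpose_mul, transpose_mul, transpose_transpose, transpose_nonsing_inv, h,
    Matrix.mul_assoc]

theorem projMat_mul_XS (hS : IsUnit (gram X S).det) : projMat X S * XS X S = XS X S := by
  rw [projMat, Matrix.mul_assoc, ← gram, Matrix.mul_assoc, nonsing_inv_mul _ hS, Matrix.mul_one]

theorem projMat_mul_XS_of_subset (hST : S ⊆ T) (hT : IsUnit (gram X T).det) :
    projMat X T * XS X S = XS X S := by
  ext i j
  exact congrFun (congrFun (projMat_mul_XS hT) i) ⟨j.1, hST j.2⟩

theorem projMat_mul_of_subset (hST : S ⊆ T) (hT : IsUnit (gram X T).det) :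
    projMat X T * projMat X S = projMat X S := by
  rw [projMat.eq_def X S, ← Matrix.mul_assoc, ← Matrix.mul_assoc, projMat_mul_XS_of_subset hST hT]

theorem projMat_mul_of_superset (hST : S ⊆ T) (hT : IsUnit (gram X T).det) :
    projMat X S * projMat X T = projMat X S := by
  have h := congrArg transpose (projMat_mul_of_subset hST hT)
  rwa [transpose_mul, projMat_transpose, projMat_transpose] at h

theorem trace_projMat (hS : IsUnit (gram X S).det) : (projMat X S).trace = S.card := by
  rw [projMat, trace_mul_comm, ← Matrix.mul_assoc, ← gram, mul_nonsing_inv _ hS, trace_one]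
  simp

theorem isHermitian_one_sub_projMat : (1 - projMat X S).IsHermitian := by
  rw [IsHermitian, conjTranspose_eq_transpose_of_trivial, transpose_sub, projMat_transpose,
    transpose_one]

theorem one_sub_projMat_mul_self (hS : IsUnit (gram X S).det) :
    (1 - projMat X S) * (1 - projMat X S) = 1 - projMat X S := by
  rw [Matrix.sub_mul, Matrix.mul_sub, Matrix.mul_sub,
    projMat_mul_of_subset (Finset.Subset.refl S) hS]
  simp

theorem isHermitian_projMat_sub_projMat : (projMat X T - projMat X S).IsHermitian := by
  rw [IsHermitian, conjTranspose_eq_transpose_of_trivial, transpose_sub, projMat_transpose,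
    projMat_transpose]

theorem projMat_sub_projMat_mul_self (hST : S ⊆ T) (hS : IsUnit (gram X S).det)
    (hT : IsUnit (gram X T).det) :
    (projMat X T - projMat X S) * (projMat X T - projMat X S) = projMat X T - projMat X S := by
  rw [Matrix.sub_mul, Matrix.mul_sub, Matrix.mul_sub, projMat_mul_of_subset hST hT,
    projMat_mul_of_superset hST hT, projMat_mul_of_subset (Finset.Subset.refl S) hS,
    projMat_mul_of_subset (Finset.Subset.refl T) hT]
  simp

theorem yHat_eq_projMat_mulVec (y : Fin n → ℝ) : yHat X S y = projMat X S *ᵥ y := by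
  rw [yHat, betaHat, projMat, mulVec_mulVec, Matrix.mul_assoc]

theorem rss_eq_quadratic (hS : IsUnit (gram X S).det) (y : Fin n → ℝ) :
    rss X S y = y ⬝ᵥ ((1 - projMat X S) *ᵥ y) := by
  have h : rss X S y = ((1 - projMat X S) *ᵥ y) ⬝ᵥ ((1 - projMat X S) *ᵥ y) := by
    simp only [rss, yHat_eq_projMat_mulVec, dotProduct, sub_mulVec, one_mulVec, Pi.sub_apply, sq]
  have ht : (1 - projMat X S)ᵀ = 1 - projMat X S := by
    rw [transpose_sub, projMat_transpose, transpose_one]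
  rw [h, dotProduct_mulVec, ← mulVec_transpose, mulVec_mulVec, ht, one_sub_projMat_mul_self hS,
    dotProduct_comm]

theorem projMat_mulVec_mulVec (hS : IsUnit (gram X S).det) {β : Fin p → ℝ}
    (hβ : Function.support β ⊆ S) : projMat X S *ᵥ (X *ᵥ β) = X *ᵥ β := by
  have h : X *ᵥ β = XS X S *ᵥ (fun j => β j.1) := by
    ext i
    simp only [mulVec, dotProduct, XS, of_apply]
    rw [Finset.sum_coe_sort S (fun j => X i j * β j)]
    refine (Finset.sum_subset (Finset.subset_univ S) fun j _ hj => ?_).symm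
    have : β j = 0 := by
      by_contra hne
      exact hj (hβ hne)
    rw [this, mul_zero]
  rw [h, mulVec_mulVec, projMat_mul_XS hS]

theorem rss_mulVec_add (hS : IsUnit (gram X S).det) {β : Fin p → ℝ}
    (hβ : Function.support β ⊆ S) (w : Fin n → ℝ) :
    rss X S (X *ᵥ β + w) = w ⬝ᵥ ((1 - projMat X S) *ᵥ w) := by
  rw [← rss_eq_quadratic hS]
  simp only [rss, yHat_eq_projMat_mulVec, mulVec_add, projMat_mulVec_mulVec hS hβ, Pi.add_apply,
    add_sub_add_left_eq_sub]

theorem rss_nonneg (y : Fin n → ℝ) : 0 ≤ rss X S y :=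
  Finset.sum_nonneg fun _ _ => sq_nonneg _

theorem gram_posDef (hS : IsUnit (gram X S).det) : (gram X S).PosDef := by
  have h : (gram X S).PosSemidef := by
    rw [gram, ← conjTranspose_eq_transpose_of_trivial]
    exact posSemidef_conjTranspose_mul_self _
  exact h.posDef_iff_isUnit.2 ((isUnit_iff_isUnit_det _).2 hS)

end Projection

section Posterior

variable {n p R : ℕ} {X : Matrix (Fin n) (Fin p) ℝ} {a₀ b₀ a c γ α : ℝ} {S : Finset (Fin p)}

theorem priorWt_pos (hp : 0 < p) (hc : 0 < c) (hS : S.card ≤ R) : 0 < priorWt p R a c S := by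
  have h1 : 0 < p.choose S.card := Nat.choose_pos (by simpa using S.card_le_univ)
  rw [priorWt, if_pos hS]
  positivity

theorem priorWt_nonneg (hc : 0 < c) : 0 ≤ priorWt p R a c S := by
  rw [priorWt]
  split_ifs <;> positivity

theorem modelWt_pos (hp : 0 < p) (hc : 0 < c) (hb₀ : 0 < b₀) (hγ : 0 < γ) (hα : 0 < α)
    (hS : S.card ≤ R) (y : Fin n → ℝ) : 0 < modelWt R X a₀ b₀ a c γ α y S := by
  have h1 := priorWt_pos (a := a) hp hc hS
  have h2 := rss_nonneg (X := X) (S := S) y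
  rw [modelWt]
  positivity

theorem measurable_augment : Measurable (augment S) := by
  refine measurable_pi_lambda _ fun j => ?_
  unfold augment
  split_ifs <;> fun_prop

theorem modelMeasure_eq_zero (hS : R < S.card) (y : Fin n → ℝ) :
    modelMeasure R X a₀ b₀ a c γ α y S = 0 := by
  have h : ∀ b, Ddens R X a₀ b₀ a c γ α y S b = 0 := fun b => by
    simp [Ddens, priorWt, not_le.2 hS]
  simp [modelMeasure, h]

/-- The total mass of the contribution of a model is proportional to its marginal weight. -/
theorem modelMeasure_univ (ha₀ : 0 < a₀) (hb₀ : 0 < b₀) (hc : 0 < c) (hγ : 0 < γ) (hα : 0 < α)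
    (hS : IsUnit (gram X S).det) (y : Fin n → ℝ) :
    modelMeasure R X a₀ b₀ a c γ α y S Set.univ =
      ENNReal.ofReal (Real.Gamma (a₀ + α * n / 2) * modelWt R X a₀ b₀ a c γ α y S) := by
  have hG := gram_posDef hS
  have hdet := hG.det_pos
  have hrss := rss_nonneg (X := X) (S := S) y
  have hpr := priorWt_nonneg (p := p) (R := R) (a := a) (S := S) hc
  set s : ℝ := (S.card : ℝ) with hs
  set m : ℝ := a₀ + α * n / 2 with hm
  have hm0 : 0 < m := by positivity
  have hcard : (Fintype.card {j // j ∈ S} : ℝ) = s := by simp [hs]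
  have ht : tExp n α a₀ S.card = m + (Fintype.card {j // j ∈ S} : ℝ) / 2 := by
    rw [hcard, tExp, hm, hs]
    ring
  have ht0 : 0 < tExp n α a₀ S.card := by
    rw [ht]
    positivity
  have hΓ := Real.Gamma_pos_of_pos ht0
  have hC : 0 < b₀ + α / 2 * rss X S y := by positivity
  have hh : 0 < (α + γ) / 2 := by positivity
  set K : ℝ := priorWt p R a c S * (2 * π) ^ (-s / 2) * √((γ • gram X S).det) with hK
  have hK0 : 0 ≤ K := by positivity
  rw [modelMeasure, Measure.map_apply measurable_augment MeasurableSet.univ, Set.preimage_univ,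
    withDensity_apply _ MeasurableSet.univ, Measure.restrict_univ]
  have h1 : ∀ b, ENNReal.ofReal (Ddens R X a₀ b₀ a c γ α y S b) = ENNReal.ofReal K *
      (ENNReal.ofReal (Real.Gamma (tExp n α a₀ S.card)) *
        ENNReal.ofReal (((b₀ + α / 2 * rss X S y) + (α + γ) / 2 *
          ((b - betaHat X S y) ⬝ᵥ (gram X S *ᵥ (b - betaHat X S y)))) ^
            (-tExp n α a₀ S.card))) := fun b => by
    rw [← ENNReal.ofReal_mul hΓ.le, ← ENNReal.ofReal_mul hK0]
    congr 1
    rw [Ddens, quadForm, hK, add_right_comm]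
    ring
  have hQc : Continuous fun b : {j // j ∈ S} → ℝ => b ⬝ᵥ (gram X S *ᵥ b) := by
    simp only [dotProduct, mulVec]
    fun_prop
  have hQm := hQc.measurable
  have hQm' : Measurable fun b : {j // j ∈ S} → ℝ =>
      (b - betaHat X S y) ⬝ᵥ (gram X S *ᵥ (b - betaHat X S y)) :=
    hQm.comp (measurable_id.sub_const _)
  simp_rw [h1]
  rw [lintegral_const_mul _ (by fun_prop), lintegral_const_mul _ (by fun_prop),
    lintegral_sub_right_eq_self (fun b : {j // j ∈ S} → ℝ =>
      ENNReal.ofReal (((b₀ + α / 2 * rss X S y) + (α + γ) / 2 * (b ⬝ᵥ (gram X S *ᵥ b))) ^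
            (-tExp n α a₀ S.card))),
    lintegral_student hG hC hh hm0 ht, ← ENNReal.ofReal_mul hK0, hcard]
  congr 1
  rw [modelWt, hK, det_smul, Fintype.card_coe, Real.sqrt_mul (by positivity)]
  have e1 : √(γ ^ S.card) = γ ^ (s / 2) := by
    rw [Real.sqrt_eq_rpow, ← Real.rpow_natCast, ← Real.rpow_mul hγ.le]
    congr 1
    ring
  have e2 : (γ / (α + γ)) ^ (s / 2) =
      (2 * π) ^ (-s / 2) * (γ ^ (s / 2) * (π / ((α + γ) / 2)) ^ (s / 2)) := by
    rw [neg_div, Real.rpow_neg (by positivity), ← Real.inv_rpow (by positivity),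
      ← Real.mul_rpow (by positivity) (by positivity),
      ← Real.mul_rpow (by positivity) (by positivity)]
    congr 1
    field_simp
  rw [e1, e2]
  have e3 : √(gram X S).det * (√(gram X S).det)⁻¹ = 1 :=
    mul_inv_cancel₀ (Real.sqrt_pos.2 hdet).ne'
  linear_combination (priorWt p R a c S * (2 * π) ^ (-s / 2) * γ ^ (s / 2) *
    (π / ((α + γ) / 2)) ^ (s / 2) * Real.Gamma m * (b₀ + α / 2 * rss X S y) ^ (-m)) * e3

theorem post_toReal_le_one (y : Fin n → ℝ) (A : Set (Fin p → ℝ)) :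
    (post R X a₀ b₀ a c γ α y A).toReal ≤ 1 := by
  refine ENNReal.toReal_le_of_le_ofReal zero_le_one ?_
  rw [post, Measure.smul_apply, smul_eq_mul, ENNReal.ofReal_one]
  exact (mul_le_mul_right (measure_mono (Set.subset_univ A)) _).trans (ENNReal.inv_mul_le_one _)

theorem measurableSet_support_ssubset (β₀ : Fin p → ℝ) :
    MeasurableSet {β : Fin p → ℝ | Function.support β₀ ⊂ Function.support β} := by
  have h : {β : Fin p → ℝ | Function.support β₀ ⊂ Function.support β} =
      (⋂ (j) (_ : β₀ j ≠ 0), {β | β j ≠ 0}) ∩ ⋃ (j) (_ : β₀ j = 0), {β | β j ≠ 0} := by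
    ext β
    simp [Set.ssubset_def, Set.subset_def, Function.mem_support, and_comm]
  have hm : ∀ j, MeasurableSet {β : Fin p → ℝ | β j ≠ 0} := fun j =>
    (measurableSet_eq_fun (measurable_pi_apply j) measurable_const).compl
  rw [h]
  exact (MeasurableSet.iInter fun j => MeasurableSet.iInter fun _ => hm j).inter
    (MeasurableSet.iUnion fun j => MeasurableSet.iUnion fun _ => hm j)

theorem modelMeasure_ssubset_eq_zero (β₀ : Fin p → ℝ) (y : Fin n → ℝ)
    (hS : ¬ suppFinset β₀ ⊂ S) :
    modelMeasure R X a₀ b₀ a c γ α y S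
      {β : Fin p → ℝ | Function.support β₀ ⊂ Function.support β} = 0 := by
  rw [modelMeasure, Measure.map_apply measurable_augment (measurableSet_support_ssubset β₀)]
  refine measure_mono_null (fun b hb => hS ?_) measure_empty
  have hb : Function.support β₀ ⊂ Function.support (augment S b) := hb
  have h1 : Function.support (augment S b) ⊆ S := by
    intro j hj
    by_contra hjS
    apply hj
    have : j ∉ S := hjS
    simp [augment, this]
  have h2 : ((suppFinset β₀ : Finset (Fin p)) : Set (Fin p)) = Function.support β₀ := by
    ext j
    simp [suppFinset]
  rw [← Finset.coe_ssubset, h2]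
  exact hb.trans_subset h1

/-- Posterior mass of proper supersets of the true support, bounded by posterior odds. -/
theorem post_ssubset_toReal_le (ha₀ : 0 < a₀) (hb₀ : 0 < b₀) (hc : 0 < c) (hγ : 0 < γ)
    (hα : 0 < α) (hp : 0 < p)
    (hinv : ∀ S : Finset (Fin p), S.card ≤ R → IsUnit (gram X S).det) (β₀ : Fin p → ℝ)
    (hβ₀ : (suppFinset β₀).card ≤ R) (y : Fin n → ℝ) :
    (post R X a₀ b₀ a c γ α y
      {β : Fin p → ℝ | Function.support β₀ ⊂ Function.support β}).toReal ≤
    ∑ S with suppFinset β₀ ⊂ S ∧ S.card ≤ R,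
      modelWt R X a₀ b₀ a c γ α y S / modelWt R X a₀ b₀ a c γ α y (suppFinset β₀) := by
  set w : Finset (Fin p) → ℝ := modelWt R X a₀ b₀ a c γ α y with hw
  have hw0 : ∀ S : Finset (Fin p), S.card ≤ R → 0 < w S := fun S hS =>
    modelWt_pos hp hc hb₀ hγ hα hS y
  have hΓ : 0 < Real.Gamma (a₀ + α * n / 2) := Real.Gamma_pos_of_pos (by positivity)
  have hws := hw0 _ hβ₀
  have hnn : ∀ S ∈ ({S | suppFinset β₀ ⊂ S ∧ S.card ≤ R} : Finset (Finset (Fin p))), 0 ≤ w S :=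
    fun S hS => (hw0 S (Finset.mem_filter.1 hS).2.2).le
  refine ENNReal.toReal_le_of_le_ofReal
    (Finset.sum_nonneg fun S hS => div_nonneg (hnn S hS) hws.le) ?_
  set A := {β : Fin p → ℝ | Function.support β₀ ⊂ Function.support β}
  have hnum : postUnnorm R X a₀ b₀ a c γ α y A ≤
      ENNReal.ofReal (Real.Gamma (a₀ + α * n / 2) *
        ∑ S with suppFinset β₀ ⊂ S ∧ S.card ≤ R, w S) := by
    rw [postUnnorm, Measure.finsetSum_apply, Finset.mul_sum,
      ENNReal.ofReal_sum_of_nonneg fun S hS => mul_nonneg hΓ.le (hnn S hS), Finset.sum_filter]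
    refine Finset.sum_le_sum fun S _ => ?_
    split_ifs with h
    · rw [← modelMeasure_univ ha₀ hb₀ hc hγ hα (hinv S h.2)]
      exact measure_mono (Set.subset_univ _)
    · refine le_of_eq ?_
      by_cases hs : suppFinset β₀ ⊂ S
      · rw [modelMeasure_eq_zero (not_le.1 fun h' => h ⟨hs, h'⟩)]
        simp
      · exact modelMeasure_ssubset_eq_zero β₀ y hs
  have hden : ENNReal.ofReal (Real.Gamma (a₀ + α * n / 2) * w (suppFinset β₀)) ≤
      postUnnorm R X a₀ b₀ a c γ α y Set.univ := by
    rw [← modelMeasure_univ ha₀ hb₀ hc hγ hα (hinv _ hβ₀), postUnnorm, Measure.finsetSum_apply]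
    exact Finset.single_le_sum
      (f := fun S => modelMeasure R X a₀ b₀ a c γ α y S Set.univ)
      (fun _ _ => zero_le) (Finset.mem_univ (suppFinset β₀))
  rw [post, Measure.smul_apply, smul_eq_mul]
  refine (mul_le_mul' (ENNReal.inv_le_inv.2 hden) hnum).trans (le_of_eq ?_)
  rw [← ENNReal.ofReal_inv_of_pos (by positivity), ← ENNReal.ofReal_mul (by positivity),
    ← Finset.sum_div]
  congr 1
  field_simp

end Posterior

section Counting

theorem choose_add_le_pow (s k : ℕ) : (s + k).choose k ≤ (s + 1) ^ k := by
  induction k with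
  | zero => simp
  | succ k ih =>
    have h := Nat.add_one_mul_choose_eq (s + k) k
    refine Nat.le_of_mul_le_mul_right (c := k + 1) ?_ k.succ_pos
    rw [← add_assoc, ← h, pow_succ, mul_assoc]
    calc (s + k + 1) * (s + k).choose k ≤ ((s + 1) * (k + 1)) * (s + 1) ^ k :=
          Nat.mul_le_mul (by nlinarith) ih
      _ = (s + 1) ^ k * ((s + 1) * (k + 1)) := mul_comm _ _

theorem choose_div_choose_mul_le {p s k : ℕ} (hk : s + k ≤ p) :
    ((p - s).choose k : ℝ) * ((p.choose s : ℝ) / (p.choose (s + k) : ℝ)) ≤ ((s : ℝ) + 1) ^ k := by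
  have h0 : 0 < p.choose (s + k) := Nat.choose_pos hk
  have h1 : p.choose (s + k) * (s + k).choose s = p.choose s * (p - s).choose k := by
    have := Nat.choose_mul (n := p) (k := s + k) (s := s) (by omega)
    rwa [Nat.add_sub_cancel_left] at this
  have h2 : (s + k).choose s = (s + k).choose k := Nat.choose_symm_add
  have h3 : p.choose s * (p - s).choose k ≤ (s + 1) ^ k * p.choose (s + k) := by
    rw [← h1, h2, mul_comm]
    exact Nat.mul_le_mul_right _ (choose_add_le_pow s k)
  rw [← mul_div_assoc, div_le_iff₀ (by exact_mod_cast h0), mul_comm]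
  exact_mod_cast h3

theorem geom_sum_le_two {u : ℝ} (h0 : 0 ≤ u) (h1 : u ≤ 1 / 2) (N : ℕ) :
    ∑ k ∈ Finset.range N, u ^ k ≤ 2 := by
  have h := geom_sum_mul u N
  have := pow_nonneg h0 N
  have h3 : 0 ≤ ∑ k ∈ Finset.range N, u ^ k := Finset.sum_nonneg fun _ _ => pow_nonneg h0 _
  nlinarith

/-- Summing complexity-prior odds over all proper supersets of a fixed model. -/
theorem sum_ssuperset_choose_div_choose_le {p : ℕ} (S₀ : Finset (Fin p)) {x : ℝ} (hx : 0 ≤ x)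
    (hu : ((S₀.card : ℝ) + 1) * x ≤ 1 / 2) :
    ∑ S with S₀ ⊂ S, (p.choose S₀.card : ℝ) / (p.choose S.card : ℝ) * x ^ (S.card - S₀.card) ≤
      2 * (((S₀.card : ℝ) + 1) * x) := by
  set s := S₀.card with hs
  set u := ((s : ℝ) + 1) * x with hu'
  have hu0 : 0 ≤ u := by positivity
  set g : ℕ → ℝ := fun k =>
    if k = 0 then 0 else (p.choose s : ℝ) / (p.choose (s + k) : ℝ) * x ^ k with hg
  have hsp : s ≤ p := by simpa using S₀.card_le_univ
  have hg0 : ∀ k, 0 ≤ g k := fun k => by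
    simp only [hg]
    split_ifs <;> positivity
  have h1 : ∑ S with S₀ ⊂ S, (p.choose s : ℝ) / (p.choose S.card : ℝ) * x ^ (S.card - s) ≤
      ∑ T ∈ S₀ᶜ.powerset, g T.card := by
    calc ∑ S with S₀ ⊂ S, (p.choose s : ℝ) / (p.choose S.card : ℝ) * x ^ (S.card - s)
        = ∑ S with S₀ ⊂ S, g (S \ S₀).card := by
          refine Finset.sum_congr rfl fun S hS => ?_
          have hS := (Finset.mem_filter.1 hS).2
          have hlt := Finset.card_lt_card hS
          rw [Finset.card_sdiff_of_subset hS.subset, ← hs]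
          simp only [hg]
          rw [if_neg (by omega), Nat.add_sub_cancel' (by omega)]
      _ = ∑ T ∈ ({S | S₀ ⊂ S} : Finset (Finset (Fin p))).image (· \ S₀), g T.card := by
          rw [Finset.sum_image]
          intro S hS T hT hST
          have hS : S₀ ⊂ S := by simpa using hS
          have hT : S₀ ⊂ T := by simpa using hT
          rw [← Finset.sdiff_union_of_subset hS.subset, ← Finset.sdiff_union_of_subset hT.subset]
          exact congrArg (· ∪ S₀) hST
      _ ≤ ∑ T ∈ S₀ᶜ.powerset, g T.card := by
          refine Finset.sum_le_sum_of_subset_of_nonneg (fun T hT => ?_) fun T _ _ => hg0 _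
          obtain ⟨S, -, rfl⟩ := Finset.mem_image.1 hT
          rw [Finset.mem_powerset]
          intro j hj
          simpa using (Finset.mem_sdiff.1 hj).2
  refine h1.trans ?_
  rw [Finset.sum_powerset_apply_card, Finset.card_compl, Fintype.card_fin, ← hs,
    Finset.sum_range_succ']
  have h2 : ∀ k ∈ Finset.range (p - s), (p - s).choose (k + 1) • g (k + 1) ≤ u * u ^ k := by
    intro k hk
    have hk := Finset.mem_range.1 hk
    simp only [hg, Nat.succ_ne_zero, if_false, nsmul_eq_mul]
    rw [← pow_succ', hu', mul_pow, ← mul_assoc]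
    exact mul_le_mul_of_nonneg_right (choose_div_choose_mul_le (by omega)) (by positivity)
  refine (add_le_add (Finset.sum_le_sum h2) (le_of_eq (by simp [hg] :
    (p - s).choose 0 • g 0 = 0))).trans ?_
  rw [← Finset.mul_sum, add_zero, mul_comm 2 u]
  exact mul_le_mul_of_nonneg_left (geom_sum_le_two hu0 hu _) hu0

theorem card_filter_card_le {p : ℕ} (hp : 0 < p) (R : ℕ) :
    ((({S | S.card ≤ R} : Finset (Finset (Fin p))).card : ℕ) : ℝ) ≤ Real.exp 1 * (p : ℝ) ^ R := by
  have hp' : (1 : ℝ) ≤ p := by exact_mod_cast hp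
  have h := Finset.sum_pow_mul_eq_add_pow ((p : ℝ)⁻¹) 1 (Finset.univ : Finset (Fin p))
  simp only [one_pow, mul_one, Finset.powerset_univ, Finset.card_univ, Fintype.card_fin] at h
  have h1 : ((p : ℝ)⁻¹ + 1) ^ p ≤ Real.exp 1 := by
    calc ((p : ℝ)⁻¹ + 1) ^ p ≤ (Real.exp (p : ℝ)⁻¹) ^ p :=
          pow_le_pow_left₀ (by positivity) (Real.add_one_le_exp _) _
      _ = Real.exp 1 := by
          rw [← Real.exp_nat_mul, mul_inv_cancel₀ (by positivity)]
  rw [← h] at h1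
  calc ((({S | S.card ≤ R} : Finset (Finset (Fin p))).card : ℕ) : ℝ)
      = ∑ S : Finset (Fin p) with S.card ≤ R, (1 : ℝ) := by simp
    _ ≤ ∑ S : Finset (Fin p) with S.card ≤ R, (p : ℝ)⁻¹ ^ S.card * (p : ℝ) ^ R := by
        refine Finset.sum_le_sum fun S hS => ?_
        rw [inv_pow, inv_mul_eq_div, one_le_div (by positivity)]
        exact pow_le_pow_right₀ hp' (Finset.mem_filter.1 hS).2
    _ ≤ ∑ S : Finset (Fin p), (p : ℝ)⁻¹ ^ S.card * (p : ℝ) ^ R :=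
        Finset.sum_le_sum_of_subset_of_nonneg (Finset.filter_subset _ _)
          fun _ _ _ => by positivity
    _ ≤ Real.exp 1 * (p : ℝ) ^ R := by
        rw [← Finset.sum_mul]
        exact mul_le_mul_of_nonneg_right h1 (by positivity)

end Counting

section Expectation

variable {n p R : ℕ} {X : Matrix (Fin n) (Fin p) ℝ} {a₀ b₀ a c γ α : ℝ} {S S₀ : Finset (Fin p)}

/-- The data-free factor of the posterior odds of `S` against `S₀`. -/
def priorOdds (p R : ℕ) (a c γ α : ℝ) (S₀ S : Finset (Fin p)) : ℝ :=
  priorWt p R a c S / priorWt p R a c S₀ *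
    ((γ / (α + γ)) ^ ((S.card : ℝ) / 2) / (γ / (α + γ)) ^ ((S₀.card : ℝ) / 2))

theorem priorOdds_nonneg (hc : 0 < c) (hγ : 0 < γ) (hα : 0 < α) :
    0 ≤ priorOdds p R a c γ α S₀ S := by
  have h1 := priorWt_nonneg (p := p) (R := R) (a := a) (S := S) hc
  have h2 := priorWt_nonneg (p := p) (R := R) (a := a) (S := S₀) hc
  rw [priorOdds]
  positivity

theorem rpow_div_rpow_le_exp {q θ v m N A Q b : ℝ} (hb : 0 < b) (hα : 0 < α) (hv : 0 < v)
    (hθ : 0 < θ) (hN : 0 < N) (hm0 : 0 < m) (hm : m ≤ q * θ * N / 2) (hA : θ * N * v ≤ A)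
    (hAQ : A ≤ Q) :
    (b + α / 2 * A) ^ (-m) / (b + α / 2 * Q) ^ (-m) ≤ Real.exp (q / 2 * ((Q - A) / v)) := by
  have hT : 0 < θ * N * v := by positivity
  have hA0 : 0 < A := hT.trans_le hA
  have hQ0 : 0 < Q := hA0.trans_le hAQ
  have hCA : 0 < b + α / 2 * A := by positivity
  have hCQ : 0 < b + α / 2 * Q := by positivity
  rw [Real.rpow_neg hCA.le, Real.rpow_neg hCQ.le, inv_div_inv, ← Real.div_rpow hCQ.le hCA.le]
  have h1 : (b + α / 2 * Q) / (b + α / 2 * A) ≤ Real.exp ((Q - A) / (θ * N * v)) := by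
    refine le_trans ?_ (Real.add_one_le_exp _)
    have h2 : (b + α / 2 * Q) / (b + α / 2 * A) = (Q - A) * (α / 2) / (b + α / 2 * A) + 1 := by
      field_simp
      ring
    rw [h2, add_le_add_iff_right, div_le_div_iff₀ hCA hT]
    have h3 : α / 2 * (θ * N * v) ≤ b + α / 2 * A := by nlinarith
    nlinarith [mul_le_mul_of_nonneg_left h3 (sub_nonneg.2 hAQ)]
  refine (Real.rpow_le_rpow (by positivity) h1 hm0.le).trans ?_
  rw [← Real.exp_mul, Real.exp_le_exp]
  have h4 : 0 ≤ (Q - A) / (θ * N * v) := div_nonneg (sub_nonneg.2 hAQ) hT.le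
  refine (mul_le_mul_of_nonneg_left hm h4).trans (le_of_eq ?_)
  field_simp

theorem modelWt_div_modelWt (y : Fin n → ℝ) :
    modelWt R X a₀ b₀ a c γ α y S / modelWt R X a₀ b₀ a c γ α y S₀ =
      priorOdds p R a c γ α S₀ S * ((b₀ + α / 2 * rss X S y) ^ (-(a₀ + α * n / 2)) /
        (b₀ + α / 2 * rss X S₀ y) ^ (-(a₀ + α * n / 2))) := by
  rw [modelWt, modelWt, priorOdds, mul_div_mul_comm, mul_div_mul_comm]

theorem rss_mulVec_add_smul (hS : IsUnit (gram X S).det) {β : Fin p → ℝ}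
    (hβ : suppFinset β ⊆ S) {v : ℝ} (hv : 0 ≤ v) (x : Fin n → ℝ) :
    rss X S (X *ᵥ β + √v • x) = v * (x ⬝ᵥ ((1 - projMat X S) *ᵥ x)) := by
  have h : Function.support β ⊆ S := fun j hj => hβ (by simpa [suppFinset] using hj)
  rw [rss_mulVec_add hS h, mulVec_smul, dotProduct_smul, smul_dotProduct, smul_eq_mul, smul_eq_mul,
    ← mul_assoc, Real.mul_self_sqrt hv]

theorem dotProduct_mulVec_nonneg_of_projection {M : Matrix (Fin n) (Fin n) ℝ}
    (hM : M.IsHermitian) (hid : M * M = M) (x : Fin n → ℝ) : 0 ≤ x ⬝ᵥ (M *ᵥ x) := by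
  have h : M.PosSemidef := by
    have := posSemidef_conjTranspose_mul_self M
    rwa [hM.eq, hid] at this
  simpa using h.dotProduct_mulVec_nonneg x

/-- The integrand whose Gaussian expectation controls the posterior mass of proper supersets. -/
def oddsMajorant (R : ℕ) (X : Matrix (Fin n) (Fin p) ℝ) (a c γ α q θ μ : ℝ)
    (S₀ : Finset (Fin p)) (x : Fin n → ℝ) : ℝ :=
  ∑ S with S₀ ⊂ S ∧ S.card ≤ R,
    (priorOdds p R a c γ α S₀ S * Real.exp (q / 2 * (x ⬝ᵥ ((projMat X S - projMat X S₀) *ᵥ x))) +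
      Real.exp (μ / 2 * (θ * n)) * Real.exp (-μ / 2 * (x ⬝ᵥ ((1 - projMat X S) *ᵥ x))))

theorem post_ssubset_toReal_le_oddsMajorant (ha₀ : 0 < a₀) (hb₀ : 0 < b₀) (hc : 0 < c)
    (hγ : 0 < γ) (hα : 0 < α) (hp : 0 < p) (hn : 0 < n)
    (hinv : ∀ S : Finset (Fin p), S.card ≤ R → IsUnit (gram X S).det) (β : Fin p → ℝ)
    (hβ : (suppFinset β).card ≤ R) {v q θ μ : ℝ} (hv : 0 < v) (hθ : 0 < θ) (hμ : 0 < μ)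
    (hm : a₀ + α * n / 2 ≤ q * θ * n / 2) (x : Fin n → ℝ) :
    (post R X a₀ b₀ a c γ α (X *ᵥ β + √v • x)
      {β' : Fin p → ℝ | Function.support β ⊂ Function.support β'}).toReal ≤
    oddsMajorant R X a c γ α q θ μ (suppFinset β) x := by
  have hn' : (0 : ℝ) < n := by exact_mod_cast hn
  have hodds : ∀ S, 0 ≤ priorOdds p R a c γ α (suppFinset β) S := fun S =>
    priorOdds_nonneg hc hγ hα
  by_cases hsmall : ∃ S, (suppFinset β ⊂ S ∧ S.card ≤ R) ∧
      x ⬝ᵥ ((1 - projMat X S) *ᵥ x) < θ * n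
  · obtain ⟨S, hS, hlt⟩ := hsmall
    refine (post_toReal_le_one _ _).trans ?_
    rw [oddsMajorant]
    refine le_trans ?_ (Finset.single_le_sum (fun T _ => ?_) (Finset.mem_filter.2
      ⟨Finset.mem_univ S, hS⟩))
    · refine le_add_of_nonneg_of_le (mul_nonneg (hodds S) (Real.exp_pos _).le) ?_
      rw [← Real.exp_add, Real.one_le_exp_iff]
      nlinarith
    · have := hodds T
      positivity
  · push Not at hsmall
    refine (post_ssubset_toReal_le ha₀ hb₀ hc hγ hα hp hinv β hβ _).trans ?_
    rw [oddsMajorant]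
    refine Finset.sum_le_sum fun S hS => ?_
    have hS := (Finset.mem_filter.1 hS).2
    refine le_add_of_le_of_nonneg ?_ (by positivity)
    rw [modelWt_div_modelWt]
    refine mul_le_mul_of_nonneg_left ?_ (hodds S)
    have hdiff : x ⬝ᵥ ((1 - projMat X (suppFinset β)) *ᵥ x) - x ⬝ᵥ ((1 - projMat X S) *ᵥ x) =
        x ⬝ᵥ ((projMat X S - projMat X (suppFinset β)) *ᵥ x) := by
      rw [← dotProduct_sub, ← sub_mulVec]
      congr 2
      abel
    have hnn : 0 ≤ x ⬝ᵥ ((projMat X S - projMat X (suppFinset β)) *ᵥ x) :=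
      dotProduct_mulVec_nonneg_of_projection isHermitian_projMat_sub_projMat
        (projMat_sub_projMat_mul_self hS.1.subset (hinv _ hβ) (hinv S hS.2)) x
    rw [rss_mulVec_add_smul (hinv S hS.2) hS.1.subset hv.le,
      rss_mulVec_add_smul (hinv _ hβ) (Finset.Subset.refl _) hv.le]
    refine (rpow_div_rpow_le_exp hb₀ hα hv hθ hn' (by positivity) hm ?_ ?_).trans (le_of_eq ?_)
    · rw [mul_comm v]
      exact mul_le_mul_of_nonneg_right (hsmall S hS) hv.le
    · exact mul_le_mul_of_nonneg_left (by linarith) hv.le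
    · rw [← mul_sub, hdiff, mul_div_cancel_left₀ _ hv.ne']

theorem integral_oddsMajorant
    (hinv : ∀ S : Finset (Fin p), S.card ≤ R → IsUnit (gram X S).det) (hS₀ : S₀.card ≤ R)
    {q θ μ : ℝ} (hq : q < 1) (hμ : 0 < μ) :
    Integrable (oddsMajorant R X a c γ α q θ μ S₀)
        (Measure.pi fun _ : Fin n => gaussianReal 0 1) ∧
      ∫ x, oddsMajorant R X a c γ α q θ μ S₀ x ∂(Measure.pi fun _ : Fin n => gaussianReal 0 1) =
        ∑ S with S₀ ⊂ S ∧ S.card ≤ R,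
          (priorOdds p R a c γ α S₀ S * (1 - q) ^ (-((S.card : ℝ) - S₀.card) / 2) +
            Real.exp (μ / 2 * (θ * n)) * (1 + μ) ^ (-((n : ℝ) - S.card) / 2)) := by
  have h1 : ∀ S ∈ ({S | S₀ ⊂ S ∧ S.card ≤ R} : Finset (Finset (Fin p))), _ := fun S hS =>
    have hS := (Finset.mem_filter.1 hS).2
    exp_quadratic_projection (isHermitian_projMat_sub_projMat (X := X) (T := S) (S := S₀))
      (projMat_sub_projMat_mul_self hS.1.subset (hinv _ hS₀) (hinv S hS.2)) hq
  have h2 : ∀ S ∈ ({S | S₀ ⊂ S ∧ S.card ≤ R} : Finset (Finset (Fin p))), _ := fun S hS =>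
    have hS := (Finset.mem_filter.1 hS).2
    exp_quadratic_projection (isHermitian_one_sub_projMat (X := X) (S := S))
      (one_sub_projMat_mul_self (hinv S hS.2)) (show -μ < 1 by linarith)
  have hint : ∀ S ∈ ({S | S₀ ⊂ S ∧ S.card ≤ R} : Finset (Finset (Fin p))),
      Integrable (fun x : Fin n → ℝ =>
        priorOdds p R a c γ α S₀ S *
            Real.exp (q / 2 * (x ⬝ᵥ ((projMat X S - projMat X S₀) *ᵥ x))) +
          Real.exp (μ / 2 * (θ * n)) * Real.exp (-μ / 2 * (x ⬝ᵥ ((1 - projMat X S) *ᵥ x))))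
        (Measure.pi fun _ : Fin n => gaussianReal 0 1) := fun S hS =>
    ((h1 S hS).1.const_mul (priorOdds p R a c γ α S₀ S)).add
      ((h2 S hS).1.const_mul (Real.exp (μ / 2 * (θ * n))))
  refine ⟨integrable_finsetSum _ hint, ?_⟩
  unfold oddsMajorant
  rw [integral_finsetSum _ hint]
  refine Finset.sum_congr rfl fun S hS => ?_
  have hS' := (Finset.mem_filter.1 hS).2
  rw [integral_add ((h1 S hS).1.const_mul _) ((h2 S hS).1.const_mul _), integral_const_mul,
    integral_const_mul, (h1 S hS).2, (h2 S hS).2, trace_sub, trace_sub, trace_one,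
    trace_projMat (hinv S hS'.2), trace_projMat (hinv _ hS₀), Fintype.card_fin, sub_neg_eq_add]

theorem integral_post_ssubset_le (ha₀ : 0 < a₀) (hb₀ : 0 < b₀) (hc : 0 < c)
    (hγ : 0 < γ) (hα : 0 < α) (hp : 0 < p) (hn : 0 < n)
    (hinv : ∀ S : Finset (Fin p), S.card ≤ R → IsUnit (gram X S).det) (β : Fin p → ℝ)
    (hβ : (suppFinset β).card ≤ R) {v q θ μ : ℝ} (hv : 0 < v) (hθ : 0 < θ) (hμ : 0 < μ)
    (hq : q < 1) (hm : a₀ + α * n / 2 ≤ q * θ * n / 2) :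
    ∫ y, (post R X a₀ b₀ a c γ α y
      {β' : Fin p → ℝ | Function.support β ⊂ Function.support β'}).toReal ∂(dataDist X β v) ≤
      ∑ S with suppFinset β ⊂ S ∧ S.card ≤ R,
          (priorOdds p R a c γ α (suppFinset β) S *
              (1 - q) ^ (-((S.card : ℝ) - (suppFinset β).card) / 2) +
            Real.exp (μ / 2 * (θ * n)) * (1 + μ) ^ (-((n : ℝ) - S.card) / 2)) := by
  obtain ⟨hI, hE⟩ := integral_oddsMajorant (a := a) (c := c) (γ := γ) (α := α) (θ := θ)
    hinv hβ hq hμ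
  set T : (Fin n → ℝ) → (Fin n → ℝ) := fun x i => (X *ᵥ β) i + √v * x i with hT
  set U : (Fin n → ℝ) → (Fin n → ℝ) := fun y => (√v)⁻¹ • (y - X *ᵥ β) with hU
  have hsv : √v ≠ 0 := (Real.sqrt_pos.2 hv).ne'
  have hUT : ∀ x, U (T x) = x := fun x => by
    ext i
    simp [hU, hT, hsv]
  have hTU : ∀ y, X *ᵥ β + √v • U y = y := fun y => by
    simp [hU, smul_smul, hsv]
  have hTm : Measurable T := by fun_prop
  have hUm : Measurable U := by fun_prop
  have hGm : Measurable (oddsMajorant R X a c γ α q θ μ (suppFinset β)) := by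
    unfold oddsMajorant
    simp only [dotProduct, mulVec]
    fun_prop
  have hGU : Measurable fun y => oddsMajorant R X a c γ α q θ μ (suppFinset β) (U y) :=
    hGm.comp hUm
  have hcomp : (fun x => oddsMajorant R X a c γ α q θ μ (suppFinset β) (U (T x))) =
      oddsMajorant R X a c γ α q θ μ (suppFinset β) := by
    ext x
    rw [hUT]
  have hD : dataDist X β v = (Measure.pi fun _ : Fin n => gaussianReal 0 1).map T :=
    gaussVec_eq_map n _ hv
  rw [← hE, hD]
  have hIm : Integrable (fun y => oddsMajorant R X a c γ α q θ μ (suppFinset β) (U y))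
      ((Measure.pi fun _ : Fin n => gaussianReal 0 1).map T) := by
    rw [integrable_map_measure hGU.aestronglyMeasurable hTm.aemeasurable]
    exact hI.congr (ae_of_all _ fun x => (congrFun hcomp x).symm)
  refine (integral_mono_of_nonneg (ae_of_all _ fun _ => ENNReal.toReal_nonneg) hIm
    (ae_of_all _ fun y => ?_)).trans (le_of_eq ?_)
  · have := post_ssubset_toReal_le_oddsMajorant (a := a) ha₀ hb₀ hc hγ hα hp hn hinv β hβ hv hθ hμ
      hm (U y)
    rwa [hTU] at this
  · rw [integral_map hTm.aemeasurable hGU.aestronglyMeasurable]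
    exact congrArg (fun f => ∫ x, f x ∂(Measure.pi fun _ : Fin n => gaussianReal 0 1)) hcomp

theorem priorOdds_mul_rpow (hp : 0 < p) (hc : 0 < c) (hγ : 0 < γ) (hα : 0 < α) {q : ℝ}
    (hq : q < 1) (hS : S₀ ⊆ S) (hSR : S.card ≤ R) :
    priorOdds p R a c γ α S₀ S * (1 - q) ^ (-((S.card : ℝ) - S₀.card) / 2) =
      (p.choose S₀.card : ℝ) / (p.choose S.card : ℝ) *
        (c⁻¹ * √(γ / (α + γ) / (1 - q)) / (p : ℝ) ^ a) ^ (S.card - S₀.card) := by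
  have hle := Finset.card_le_card hS
  obtain ⟨k, hk⟩ := Nat.exists_eq_add_of_le hle
  have h1q : 0 < 1 - q := by linarith
  have hpa : 0 < (p : ℝ) ^ a := by positivity
  have hg : 0 < γ / (α + γ) := by positivity
  rw [priorOdds, priorWt, priorWt, if_pos hSR, if_pos (hle.trans hSR), hk, Nat.add_sub_cancel_left]
  have hroot : ∀ b : ℝ, 0 < b → b ^ ((k : ℝ) / 2) = √b ^ k := fun b hb => by
    rw [Real.sqrt_eq_rpow, ← Real.rpow_natCast, ← Real.rpow_mul hb.le]
    congr 1
    ring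
  have e1 : (γ / (α + γ)) ^ (((S₀.card + k : ℕ) : ℝ) / 2) / (γ / (α + γ)) ^ ((S₀.card : ℝ) / 2) =
      √(γ / (α + γ)) ^ k := by
    rw [← Real.rpow_sub hg, ← hroot _ hg]
    congr 1
    push_cast
    ring
  have e2 : (1 - q) ^ (-(((S₀.card + k : ℕ) : ℝ) - S₀.card) / 2) = (√(1 - q) ^ k)⁻¹ := by
    rw [← hroot _ h1q, ← Real.rpow_neg h1q.le]
    congr 1
    push_cast
    ring
  have e3 : (c * (p : ℝ) ^ a) ^ (-((S₀.card + k : ℕ) : ℝ)) =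
      (c * (p : ℝ) ^ a) ^ (-(S₀.card : ℝ)) * ((c * (p : ℝ) ^ a) ^ k)⁻¹ := by
    rw [← Real.rpow_natCast _ k, ← Real.rpow_neg (by positivity), ← Real.rpow_add (by positivity)]
    congr 1
    push_cast
    ring
  have h0 : 0 < (c * (p : ℝ) ^ a) ^ (-(S₀.card : ℝ)) := by positivity
  have hs0 : (0 : ℝ) < p.choose S₀.card := by
    exact_mod_cast Nat.choose_pos (by simpa using S₀.card_le_univ)
  rw [e1, e2, e3, Real.sqrt_div hg.le, div_pow, mul_pow, mul_pow, div_pow, inv_pow]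
  field_simp

/-- Nonasymptotic bound on the expected posterior mass of proper supersets. -/
theorem integral_post_ssubset_le_add (ha₀ : 0 < a₀) (hb₀ : 0 < b₀) (hc : 0 < c)
    (hγ : 0 < γ) (hα : 0 < α) (hp : 0 < p) (hn : 0 < n)
    (hinv : ∀ S : Finset (Fin p), S.card ≤ R → IsUnit (gram X S).det) (β : Fin p → ℝ)
    (hβ : (suppFinset β).card ≤ R) {v q θ μ : ℝ} (hv : 0 < v) (hθ : 0 < θ) (hμ : 0 < μ)
    (hq : q < 1) (hm : a₀ + α * n / 2 ≤ q * θ * n / 2)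
    (hu : (((suppFinset β).card : ℝ) + 1) * (c⁻¹ * √(γ / (α + γ) / (1 - q)) / (p : ℝ) ^ a) ≤
      1 / 2) :
    ∫ y, (post R X a₀ b₀ a c γ α y
      {β' : Fin p → ℝ | Function.support β ⊂ Function.support β'}).toReal ∂(dataDist X β v) ≤
      2 * ((((suppFinset β).card : ℝ) + 1) *
          (c⁻¹ * √(γ / (α + γ) / (1 - q)) / (p : ℝ) ^ a)) +
        Real.exp (1 + R * Real.log p + μ * θ * n / 2 - (n - R) / 2 * Real.log (1 + μ)) := by
  refine (integral_post_ssubset_le ha₀ hb₀ hc hγ hα hp hn hinv β hβ hv hθ hμ hq hm).trans ?_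
  rw [Finset.sum_add_distrib]
  refine add_le_add ?_ ?_
  · refine le_trans ?_ (sum_ssuperset_choose_div_choose_le (suppFinset β) (by positivity) hu)
    calc _ = ∑ S with suppFinset β ⊂ S ∧ S.card ≤ R,
          (p.choose (suppFinset β).card : ℝ) / (p.choose S.card : ℝ) *
            (c⁻¹ * √(γ / (α + γ) / (1 - q)) / (p : ℝ) ^ a) ^ (S.card - (suppFinset β).card) :=
          Finset.sum_congr rfl fun S hS =>
            have hS := (Finset.mem_filter.1 hS).2
            priorOdds_mul_rpow hp hc hγ hα hq hS.1.subset hS.2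
      _ ≤ _ := Finset.sum_le_sum_of_subset_of_nonneg
          (Finset.monotone_filter_right _ fun S _ hS => hS.1) fun S _ _ => by positivity
  · have hp' : (0 : ℝ) < p := by exact_mod_cast hp
    calc _ ≤ ∑ S : Finset (Fin p) with suppFinset β ⊂ S ∧ S.card ≤ R,
          Real.exp (μ / 2 * (θ * n)) * (1 + μ) ^ (-((n : ℝ) - R) / 2) := by
          refine Finset.sum_le_sum fun S hS => ?_
          have hS : (S.card : ℝ) ≤ R := by exact_mod_cast (Finset.mem_filter.1 hS).2.2
          exact mul_le_mul_of_nonneg_left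
            (Real.rpow_le_rpow_of_exponent_le (by linarith) (by linarith)) (Real.exp_pos _).le
      _ ≤ ∑ S : Finset (Fin p) with S.card ≤ R,
          Real.exp (μ / 2 * (θ * n)) * (1 + μ) ^ (-((n : ℝ) - R) / 2) :=
          Finset.sum_le_sum_of_subset_of_nonneg
            (Finset.monotone_filter_right _ fun S _ hS => hS.2) fun S _ _ => by positivity
      _ ≤ Real.exp 1 * (p : ℝ) ^ R *
          (Real.exp (μ / 2 * (θ * n)) * (1 + μ) ^ (-((n : ℝ) - R) / 2)) := by
          rw [Finset.sum_const, nsmul_eq_mul]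
          exact mul_le_mul_of_nonneg_right (card_filter_card_le hp R) (by positivity)
      _ = _ := by
          rw [← Real.rpow_natCast, Real.rpow_def_of_pos hp', Real.rpow_def_of_pos (by linarith),
            ← Real.exp_add, ← Real.exp_add, ← Real.exp_add]
          congr 1
          ring

end Expectation

/-- For large `n` the exponential remainder in `integral_post_ssubset_le_add` is negligible. -/
theorem tendsto_exp_card_remainder {p R : ℕ → ℕ} (hp : Tendsto p atTop atTop)
    (hR : (fun n => (R n : ℝ) * Real.log (p n)) =o[atTop] fun n => (n : ℝ))
    {μ θ : ℝ} (hμ : 0 < μ) (hμ1 : μ ≤ 1) (hθ : θ < 1 / (1 + μ)) :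
    Tendsto (fun n : ℕ => Real.exp (1 + R n * Real.log (p n) + μ * θ * n / 2 -
      (n - R n) / 2 * Real.log (1 + μ))) atTop (nhds 0) := by
  have hlog : μ / (1 + μ) ≤ Real.log (1 + μ) := by
    have := Real.one_sub_inv_le_log_of_pos (show 0 < 1 + μ by linarith)
    refine le_trans (le_of_eq ?_) this
    field_simp
    ring
  have hlog1 : Real.log (1 + μ) ≤ 1 := by
    have := Real.log_le_sub_one_of_pos (show 0 < 1 + μ by linarith)
    linarith
  have hκ : 0 < Real.log (1 + μ) - μ * θ := by
    have := mul_lt_mul_of_pos_left hθ hμ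
    rw [mul_one_div] at this
    linarith
  set κ := Real.log (1 + μ) - μ * θ with hκdef
  have hlogp : Tendsto (fun n => Real.log (p n)) atTop atTop :=
    Real.tendsto_log_atTop.comp (tendsto_natCast_atTop_atTop.comp hp)
  have hlim : Tendsto (fun n : ℕ => Real.exp (1 - κ / 4 * n)) atTop (nhds 0) := by
    refine Real.tendsto_exp_atBot.comp ?_
    simp only [sub_eq_add_neg]
    exact tendsto_atBot_add_const_left _ _ (tendsto_neg_atTop_atBot.comp
      (tendsto_natCast_atTop_atTop.const_mul_atTop (by linarith)))
  refine squeeze_zero' (Eventually.of_forall fun _ => (Real.exp_pos _).le) ?_ hlim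
  filter_upwards [hlogp.eventually_ge_atTop 1, hR.bound (show 0 < κ / 8 by linarith)]
    with n h1 h2
  have hRn : (0 : ℝ) ≤ R n := Nat.cast_nonneg _
  rw [Real.norm_of_nonneg (mul_nonneg hRn (by linarith)), Real.norm_of_nonneg (Nat.cast_nonneg n)]
    at h2
  have h3 : (R n : ℝ) / 2 * Real.log (1 + μ) ≤ R n * Real.log (p n) := by
    have := mul_le_mul_of_nonneg_left hlog1 hRn
    have := mul_le_mul_of_nonneg_left h1 hRn
    linarith
  rw [Real.exp_le_exp]
  have h4 : κ * n = Real.log (1 + μ) * n - μ * θ * n := by rw [hκdef]; ring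
  linarith

/-- If `p^a / s → ∞` and `p → ∞` then `(s + 1) p^{-a} → 0`. -/
theorem tendsto_add_one_mul_div_rpow {p s : ℕ → ℕ} (hp : Tendsto p atTop atTop) {a : ℝ}
    (ha : 0 < a) (h : Tendsto (fun n => (p n : ℝ) ^ a / (s n : ℝ)) atTop atTop) (C : ℝ) :
    Tendsto (fun n => ((s n : ℝ) + 1) * (C / (p n : ℝ) ^ a)) atTop (nhds 0) := by
  have h1 : Tendsto (fun n => ((p n : ℝ) ^ a / (s n : ℝ))⁻¹) atTop (nhds 0) :=
    tendsto_inv_atTop_zero.comp h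
  have h2 : Tendsto (fun n => ((p n : ℝ) ^ a)⁻¹) atTop (nhds 0) :=
    tendsto_inv_atTop_zero.comp
      ((tendsto_rpow_atTop ha).comp (tendsto_natCast_atTop_atTop.comp hp))
  have h3 := (h1.add h2).const_mul C
  rw [add_zero, mul_zero] at h3
  refine h3.congr fun n => ?_
  rw [inv_div]
  ring

/-- No proper supersets of the true model (Theorem 2): under `s* ≤ R`, (A1)–(A3) and
`p^a/s* → ∞`, the posterior probability of `{β : S_β ⊋ S*}` tends to `0` in expectation. -/
theorem no_proper_supersets
    (p R sstar : ℕ → ℕ) (X : ∀ n, Matrix (Fin n) (Fin (p n)) ℝ)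
    (βstar : ∀ n, Fin (p n) → ℝ) (σ0sq : ℕ → ℝ) (a₀ b₀ a c γ α d₁ d₂ : ℝ)
    (ha₀ : 0 < a₀) (hb₀ : 0 < b₀) (ha : 0 < a) (hc : 0 < c) (hγ : 0 < γ)
    (hα0 : 0 < α) (hα1 : α < 1)
    (hnp : ∀ n, n ≤ p n) (hptop : Tendsto (fun n => p n) atTop atTop)
    (hrank : ∀ n, (X n).rank = R n)
    (hinv : ∀ n (S : Finset (Fin (p n))), S.card ≤ R n → IsUnit (gram (X n) S).det)
    (hsstar : ∀ n, sstar n = (Function.support (βstar n)).ncard)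
    (hsR : ∀ n, sstar n ≤ R n)
    (hd₁ : 0 < d₁) (hA1 : ∀ n, d₁ < σ0sq n ∧ σ0sq n < d₂)
    (hA2 : (fun n => (sstar n : ℝ) * Real.log (p n)) =o[atTop] fun n => (n : ℝ))
    (hA3 : (fun n => (R n : ℝ) * Real.log (p n)) =o[atTop] fun n => (n : ℝ))
    (hpa : Tendsto (fun n => (p n : ℝ) ^ a / (sstar n : ℝ)) atTop atTop) :
    Tendsto (fun n =>
      ∫ y, ((post (R n) (X n) a₀ b₀ a c γ α y)
          {β : Fin (p n) → ℝ | Function.support (βstar n) ⊂ Function.support β}).toReal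
        ∂(dataDist (X n) (βstar n) (σ0sq n))) atTop (nhds 0) := by
  have hcard : ∀ n, (suppFinset (βstar n)).card = sstar n := fun n => by
    rw [hsstar, ← Set.ncard_coe_finset]
    congr 1
    ext j
    simp [suppFinset]
  have hα' : 0 < 1 - α := sub_pos.2 hα1
  have hq : (3 * α + 1) / (2 * (1 + α)) < 1 := by
    rw [div_lt_one (by positivity)]
    linarith
  have hqθ : (3 * α + 1) / (2 * (1 + α)) * ((1 + α) / 2) = (3 * α + 1) / 4 := by
    field_simp
    ring
  set q := (3 * α + 1) / (2 * (1 + α)) with hqdef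
  set C := c⁻¹ * √(γ / (α + γ) / (1 - q)) with hC
  have hθ : (1 + α) / 2 < 1 / (1 + (1 - α) / 2) := by
    rw [lt_div_iff₀ (by linarith)]
    nlinarith
  have h1 := tendsto_add_one_mul_div_rpow hptop ha hpa C
  have h2 := tendsto_exp_card_remainder hptop hA3 (μ := (1 - α) / 2) (by linarith)
    (by linarith) hθ
  have h3 := (h1.const_mul 2).add h2
  rw [mul_zero, add_zero] at h3
  refine squeeze_zero' (Eventually.of_forall fun n => integral_nonneg fun _ =>
    ENNReal.toReal_nonneg) ?_ h3
  have hlin : Tendsto (fun n : ℕ => (1 - α) / 8 * (n : ℝ)) atTop atTop :=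
    tendsto_natCast_atTop_atTop.const_mul_atTop (by linarith)
  filter_upwards [eventually_gt_atTop 0, hlin.eventually_ge_atTop a₀,
    h1.eventually_le_const (show (0 : ℝ) < 1 / 2 by norm_num)] with n hn hna hu
  have hm : a₀ + α * n / 2 ≤ q * ((1 + α) / 2) * n / 2 := by
    rw [hqθ]
    linarith
  have := integral_post_ssubset_le_add (a := a) (R := R n) (X := X n) ha₀ hb₀ hc hγ hα0
    (hn.trans_le (hnp n)) hn (hinv n) (βstar n) (by rw [hcard]; exact hsR n)
    (hd₁.trans (hA1 n).1) (θ := (1 + α) / 2) (μ := (1 - α) / 2) (by linarith) (by linarith)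
    hq hm (by rw [hcard]; exact hu)
  rwa [hcard] at this

end EmpiricalBayes
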